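/- arXiv:2403.15927 — 5 statements merged into one kernel-verified Lean document; each statement's English description precedes it below -/
import Mathlib

section
/- Lemma 4.1 (KKT necessary condition): Let (y,φ) be loop-free feasible and stationary for the aggregated cost minimization problem, i.e. for every feasible pair (ŷ,φ̂): Σ_{i,m,k} Σ_{j∈{0}∪N(i)} ∂T/∂φc_{ij}(m,k)·(φ̂c_{ij}(m,k) − φc_{ij}(m,k)) + Σ_{i,k} Σ_{j∈N(i)} ∂T/∂φd_{ij}(k)·(φ̂d_{ij}(k) − φd_{ij}(k)) + Σ_{i,m,k} ∂T/∂yc_i(m,k)·(ŷc_i(m,k) − yc_i(m,k)) + Σ_{i,k} ∂T/∂yd_i(k)·(ŷd_i(k) − yd_i(k)) ≥ 0. Then, defining λc_{imk} := min{∂T/∂yc_i(m,k), min_{j∈{0}∪N(i)} ∂T/∂φc_{ij}(m,k)} and λd_{ik} := min{∂T/∂yd_i(k), min_{j∈N(i)} ∂T/∂φd_{ij}(k)}, for all i ∈ V, m ∈ 𝓕, k ∈ 𝓒: ∂T/∂φc_{ij}(m,k) = λc_{imk} for every j ∈ {0}∪N(i) with φc_{ij}(m,k) > 0 (and ≥ λc_{imk}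 in general); ∂T/∂yc_i(m,k) = λc_{imk} if yc_i(m,k) > 0 (and ≥ λc_{imk} in general); ∂T/∂φd_{ij}(k) = λd_{ik} for every j ∈ N(i) with φd_{ij}(k) > 0 (and ≥ λd_{ik} in general); and ∂T/∂yd_i(k) = λd_{ik} if yd_i(k) > 0 (and ≥ λd_{ik} in general). -/
open scoped BigOperators

/-! Cache-enabled computing network model of "LOAM" (Zhang–Yeh). -/

/-- Static data of a cache-enabled computing network: a finite directed graph on node set `V`
(each node having an out-neighbor), catalogs `𝓕` of computations and `𝓒` of data objects,
request rates `r`, designated server sets `Sv`, packet sizes `Lc`, `Ld`, workloads `W`, and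
link / computation / caching cost functions `Dl`, `Cc`, `Bc` that are continuously
differentiable, nondecreasing, convex and vanish at `0` on `[0,∞)`. -/
structure Net (V 𝓕 𝓒 : Type) [Fintype V] [DecidableEq V] [Fintype 𝓕] [Fintype 𝓒] where
  E : Finset (V × V)
  hout : ∀ i : V, ∃ j : V, (i, j) ∈ E
  r : V → 𝓕 → 𝓒 → ℝ
  hr : ∀ i m k, 0 ≤ r i m k
  Sv : 𝓒 → Finset V
  hSv : ∀ k, (Sv k).Nonempty
  Lc : 𝓕 → 𝓒 → ℝ
  hLc : ∀ m k, 0 < Lc m k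
  Ld : 𝓒 → ℝ
  hLd : ∀ k, 0 < Ld k
  W : V → 𝓕 → 𝓒 → ℝ
  hW : ∀ i m k, 0 ≤ W i m k
  Dl : V → V → ℝ → ℝ
  Cc : V → ℝ → ℝ
  Bc : V → ℝ → ℝ
  hDl : ∀ i j, ContDiffOn ℝ 1 (Dl i j) (Set.Ici 0) ∧ MonotoneOn (Dl i j) (Set.Ici 0) ∧
    ConvexOn ℝ (Set.Ici 0) (Dl i j) ∧ Dl i j 0 = 0
  hCc : ∀ i, ContDiffOn ℝ 1 (Cc i) (Set.Ici 0) ∧ MonotoneOn (Cc i) (Set.Ici 0) ∧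
    ConvexOn ℝ (Set.Ici 0) (Cc i) ∧ Cc i 0 = 0
  hBc : ∀ i, ContDiffOn ℝ 1 (Bc i) (Set.Ici 0) ∧ MonotoneOn (Bc i) (Set.Ici 0) ∧
    ConvexOn ℝ (Set.Ici 0) (Bc i) ∧ Bc i 0 = 0

namespace Net

variable {V 𝓕 𝓒 : Type} [Fintype V] [DecidableEq V] [Fintype 𝓕] [Fintype 𝓒]

/-- Out-neighbors `N(i)` of node `i`. -/
def nbr (net : Net V 𝓕 𝓒) (i : V) : Finset V :=
  Finset.univ.filter (fun j => (i, j) ∈ net.E)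

theorem nbr_nonempty (net : Net V 𝓕 𝓒) (i : V) : (net.nbr i).Nonempty := by
  obtain ⟨j, hj⟩ := net.hout i
  exact ⟨j, by simp [nbr, hj]⟩

/-- A forwarding strategy `(φc, φd)` takes values in `[0,1]` and is supported on the
edges of the graph; the local-computation index `0` is encoded as `none : Option V`,
and `φd i j k = 0` whenever `(i,j) ∉ E` or `i ∈ S_k`. -/
def ValidPhi (net : Net V 𝓕 𝓒) (φc : V → Option V → 𝓕 → 𝓒 → ℝ)
    (φd : V → V → 𝓒 → ℝ) : Prop :=
  (∀ i j m k, 0 ≤ φc i j m k ∧ φc i j m k ≤ 1) ∧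
  (∀ i j k, 0 ≤ φd i j k ∧ φd i j k ≤ 1) ∧
  (∀ i j m k, (i, j) ∉ net.E → φc i (some j) m k = 0) ∧
  (∀ i j k, ((i, j) ∉ net.E ∨ i ∈ net.Sv k) → φd i j k = 0)

/-- Feasibility of a caching / forwarding pair `(y, φ)` (flow conservation (3)). -/
def Feasible (net : Net V 𝓕 𝓒) (yc : V → 𝓕 → 𝓒 → ℝ) (yd : V → 𝓒 → ℝ)
    (φc : V → Option V → 𝓕 → 𝓒 → ℝ) (φd : V → V → 𝓒 → ℝ) : Prop :=
  net.ValidPhi φc φd ∧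
  (∀ i m k, 0 ≤ yc i m k ∧ yc i m k ≤ 1) ∧
  (∀ i k, 0 ≤ yd i k ∧ yd i k ≤ 1) ∧
  (∀ i m k, (φc i none m k + ∑ j, φc i (some j) m k) + yc i m k = 1) ∧
  (∀ i k, (∑ j, φd i j k) + yd i k = if i ∈ net.Sv k then 0 else 1)

/-- A relation is acyclic if there is no directed cycle. -/
def Acyclic {α : Type*} (R : α → α → Prop) : Prop :=
  ∀ (p : ℕ) (f : ℕ → α), 1 ≤ p → f p = f 0 → ∃ t < p, ¬ R (f t) (f (t + 1))

/-- `φ` is loop-free: the support digraphs of the CI and DI forwarding strategies are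
acyclic (for every `(m,k)` resp. every `k`). -/
def LoopFree (net : Net V 𝓕 𝓒) (φc : V → Option V → 𝓕 → 𝓒 → ℝ)
    (φd : V → V → 𝓒 → ℝ) : Prop :=
  (∀ m k, Acyclic (fun i j => 0 < φc i (some j) m k)) ∧
  (∀ k, Acyclic (fun i j => 0 < φd i j k))

/-- `(tc, td)` solve the traffic equations (2) for `(φc, φd)`; here
`g i m k = tc i m k * φc i none m k`. -/
def IsTraffic (net : Net V 𝓕 𝓒) (φc : V → Option V → 𝓕 → 𝓒 → ℝ)
    (φd : V → V → 𝓒 → ℝ) (tc : V → 𝓕 → 𝓒 → ℝ) (td : V → 𝓒 → ℝ) : Prop :=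
  (∀ i m k, tc i m k = net.r i m k + ∑ j, φc j (some i) m k * tc j m k) ∧
  (∀ i k, td i k = (∑ m, tc i m k * φc i none m k) + ∑ j, φd j i k * td j k)

/-- Total flow rate `F_{ij}` on link `(i,j)`. -/
def Fl (net : Net V 𝓕 𝓒) (φc : V → Option V → 𝓕 → 𝓒 → ℝ) (φd : V → V → 𝓒 → ℝ)
    (tc : V → 𝓕 → 𝓒 → ℝ) (td : V → 𝓒 → ℝ) (i j : V) : ℝ :=
  (∑ m, ∑ k, net.Lc m k * (tc j m k * φc j (some i) m k)) +
    ∑ k, net.Ld k * (td j k * φd j i k)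

/-- Total computation workload `G_i` at node `i`. -/
def Gl (net : Net V 𝓕 𝓒) (φc : V → Option V → 𝓕 → 𝓒 → ℝ)
    (tc : V → 𝓕 → 𝓒 → ℝ) (i : V) : ℝ :=
  ∑ m, ∑ k, net.W i m k * (tc i m k * φc i none m k)

/-- Expected cache size `Y_i` at node `i`. -/
def Yl (net : Net V 𝓕 𝓒) (yc : V → 𝓕 → 𝓒 → ℝ) (yd : V → 𝓒 → ℝ) (i : V) : ℝ :=
  (∑ m, ∑ k, net.Lc m k * yc i m k) + ∑ k, net.Ld k * yd i k

/-- Network aggregated cost `T(y,φ)`. -/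
noncomputable def Tcost (net : Net V 𝓕 𝓒) (yc : V → 𝓕 → 𝓒 → ℝ) (yd : V → 𝓒 → ℝ)
    (φc : V → Option V → 𝓕 → 𝓒 → ℝ) (φd : V → V → 𝓒 → ℝ)
    (tc : V → 𝓕 → 𝓒 → ℝ) (td : V → 𝓒 → ℝ) : ℝ :=
  (∑ e ∈ net.E, net.Dl e.1 e.2 (net.Fl φc φd tc td e.1 e.2)) +
    (∑ i, net.Bc i (net.Yl yc yd i)) + ∑ i, net.Cc i (net.Gl φc tc i)

/-- `(ptc, ptd)` solve the marginal-cost recursions (9) and (11) for `∂T/∂tc` and `∂T/∂td`. -/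
noncomputable def IsMarginal (net : Net V 𝓕 𝓒) (φc : V → Option V → 𝓕 → 𝓒 → ℝ)
    (φd : V → V → 𝓒 → ℝ) (tc : V → 𝓕 → 𝓒 → ℝ) (td : V → 𝓒 → ℝ)
    (ptc : V → 𝓕 → 𝓒 → ℝ) (ptd : V → 𝓒 → ℝ) : Prop :=
  (∀ i k, ptd i k = ∑ j, φd i j k *
      (net.Ld k * deriv (net.Dl j i) (net.Fl φc φd tc td j i) + ptd j k)) ∧
  (∀ i m k, ptc i m k =
      (∑ j, φc i (some j) m k *
        (net.Lc m k * deriv (net.Dl j i) (net.Fl φc φd tc td j i) + ptc j m k)) +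
      φc i none m k * (net.W i m k * deriv (net.Cc i) (net.Gl φc tc i) + ptd i k))

/-- Modified marginal `δc_{ij}(m,k)`; `j = none` is the local-computation direction. -/
noncomputable def deltaC (net : Net V 𝓕 𝓒) (φc : V → Option V → 𝓕 → 𝓒 → ℝ)
    (φd : V → V → 𝓒 → ℝ) (tc : V → 𝓕 → 𝓒 → ℝ) (td : V → 𝓒 → ℝ)
    (ptc : V → 𝓕 → 𝓒 → ℝ) (ptd : V → 𝓒 → ℝ) (i : V) (j : Option V) (m : 𝓕) (k : 𝓒) : ℝ :=
  match j with
  | none => net.W i m k * deriv (net.Cc i) (net.Gl φc tc i) + ptd i k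
  | some j => net.Lc m k * deriv (net.Dl j i) (net.Fl φc φd tc td j i) + ptc j m k

/-- Modified marginal `δd_{ij}(k)`. -/
noncomputable def deltaD (net : Net V 𝓕 𝓒) (φc : V → Option V → 𝓕 → 𝓒 → ℝ)
    (φd : V → V → 𝓒 → ℝ) (tc : V → 𝓕 → 𝓒 → ℝ) (td : V → 𝓒 → ℝ)
    (ptd : V → 𝓒 → ℝ) (i j : V) (k : 𝓒) : ℝ :=
  net.Ld k * deriv (net.Dl j i) (net.Fl φc φd tc td j i) + ptd j k

/-- Caching marginal `γc_i(m,k)` (its finite value; it is `+∞` when `tc i m k = 0`). -/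
noncomputable def gammaC (net : Net V 𝓕 𝓒) (yc : V → 𝓕 → 𝓒 → ℝ) (yd : V → 𝓒 → ℝ)
    (tc : V → 𝓕 → 𝓒 → ℝ) (i : V) (m : 𝓕) (k : 𝓒) : ℝ :=
  net.Lc m k * deriv (net.Bc i) (net.Yl yc yd i) / tc i m k

/-- Caching marginal `γd_i(k)` (its finite value; it is `+∞` when `td i k = 0`). -/
noncomputable def gammaD (net : Net V 𝓕 𝓒) (yc : V → 𝓕 → 𝓒 → ℝ) (yd : V → 𝓒 → ℝ)
    (td : V → 𝓒 → ℝ) (i : V) (k : 𝓒) : ℝ :=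
  net.Ld k * deriv (net.Bc i) (net.Yl yc yd i) / td i k

/-- `dC i m k` is the (finite) minimum modified marginal
`δc_{imk} = min{γc_i(m,k), min_{j∈{0}∪N(i)} δc_{ij}(m,k)}`, where `γc_i(m,k)` is `+∞`
(hence not a candidate) when `tc i m k = 0`. -/
noncomputable def IsMinC (net : Net V 𝓕 𝓒) (yc : V → 𝓕 → 𝓒 → ℝ) (yd : V → 𝓒 → ℝ)
    (φc : V → Option V → 𝓕 → 𝓒 → ℝ) (φd : V → V → 𝓒 → ℝ)
    (tc : V → 𝓕 → 𝓒 → ℝ) (td : V → 𝓒 → ℝ)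
    (ptc : V → 𝓕 → 𝓒 → ℝ) (ptd : V → 𝓒 → ℝ) (dC : V → 𝓕 → 𝓒 → ℝ) : Prop :=
  ∀ i m k,
    dC i m k ≤ net.deltaC φc φd tc td ptc ptd i none m k ∧
    (∀ j ∈ net.nbr i, dC i m k ≤ net.deltaC φc φd tc td ptc ptd i (some j) m k) ∧
    (0 < tc i m k → dC i m k ≤ net.gammaC yc yd tc i m k) ∧
    ((0 < tc i m k ∧ dC i m k = net.gammaC yc yd tc i m k) ∨
      dC i m k = net.deltaC φc φd tc td ptc ptd i none m k ∨
      ∃ j ∈ net.nbr i, dC i m k = net.deltaC φc φd tc td ptc ptd i (some j) m k)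

/-- `dD i k` is the (finite) minimum modified marginal
`δd_{ik} = min{γd_i(k), min_{j∈N(i)} δd_{ij}(k)}`, where `γd_i(k)` is `+∞`
(hence not a candidate) when `td i k = 0`. -/
noncomputable def IsMinD (net : Net V 𝓕 𝓒) (yc : V → 𝓕 → 𝓒 → ℝ) (yd : V → 𝓒 → ℝ)
    (φc : V → Option V → 𝓕 → 𝓒 → ℝ) (φd : V → V → 𝓒 → ℝ)
    (tc : V → 𝓕 → 𝓒 → ℝ) (td : V → 𝓒 → ℝ) (ptd : V → 𝓒 → ℝ) (dD : V → 𝓒 → ℝ) : Prop :=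
  ∀ i k,
    (∀ j ∈ net.nbr i, dD i k ≤ net.deltaD φc φd tc td ptd i j k) ∧
    (0 < td i k → dD i k ≤ net.gammaD yc yd td i k) ∧
    ((0 < td i k ∧ dD i k = net.gammaD yc yd td i k) ∨
      ∃ j ∈ net.nbr i, dD i k = net.deltaD φc φd tc td ptd i j k)

/-- Condition (21) at `(y, φ)`, with `dC`, `dD` the minimum modified marginals
`δc_{imk}`, `δd_{ik}`. -/
noncomputable def Cond21 (net : Net V 𝓕 𝓒) (yc : V → 𝓕 → 𝓒 → ℝ) (yd : V → 𝓒 → ℝ)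
    (φc : V → Option V → 𝓕 → 𝓒 → ℝ) (φd : V → V → 𝓒 → ℝ)
    (tc : V → 𝓕 → 𝓒 → ℝ) (td : V → 𝓒 → ℝ)
    (ptc : V → 𝓕 → 𝓒 → ℝ) (ptd : V → 𝓒 → ℝ)
    (dC : V → 𝓕 → 𝓒 → ℝ) (dD : V → 𝓒 → ℝ) : Prop :=
  ∀ i m k,
    (0 < φc i none m k → net.deltaC φc φd tc td ptc ptd i none m k = dC i m k) ∧
    (∀ j ∈ net.nbr i, 0 < φc i (some j) m k →
      net.deltaC φc φd tc td ptc ptd i (some j) m k = dC i m k) ∧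
    (∀ j ∈ net.nbr i, 0 < φd i j k → net.deltaD φc φd tc td ptd i j k = dD i k) ∧
    (0 < yc i m k → 0 < tc i m k ∧ net.gammaC yc yd tc i m k = dC i m k) ∧
    (0 < yd i k → 0 < td i k ∧ net.gammaD yc yd td i k = dD i k)

end Net

namespace Net

variable {V 𝓕 𝓒 : Type} [Fintype V] [DecidableEq V] [Fintype 𝓕] [Fintype 𝓒]

/-- `λc_{imk} = min{∂T/∂yc_i(m,k), min_{j∈{0}∪N(i)} ∂T/∂φc_{ij}(m,k)}`. -/
noncomputable def lamC (net : Net V 𝓕 𝓒) (yc : V → 𝓕 → 𝓒 → ℝ) (yd : V → 𝓒 → ℝ)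
    (φc : V → Option V → 𝓕 → 𝓒 → ℝ) (φd : V → V → 𝓒 → ℝ)
    (tc : V → 𝓕 → 𝓒 → ℝ) (td : V → 𝓒 → ℝ)
    (ptc : V → 𝓕 → 𝓒 → ℝ) (ptd : V → 𝓒 → ℝ) (i : V) (m : 𝓕) (k : 𝓒) : ℝ :=
  min (net.Lc m k * deriv (net.Bc i) (net.Yl yc yd i))
    ((insert (none : Option V) ((net.nbr i).image some)).inf'
      (Finset.insert_nonempty _ _)
      (fun j => tc i m k * net.deltaC φc φd tc td ptc ptd i j m k))

/-- `λd_{ik} = min{∂T/∂yd_i(k), min_{j∈N(i)} ∂T/∂φd_{ij}(k)}`. -/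
noncomputable def lamD (net : Net V 𝓕 𝓒) (yc : V → 𝓕 → 𝓒 → ℝ) (yd : V → 𝓒 → ℝ)
    (φc : V → Option V → 𝓕 → 𝓒 → ℝ) (φd : V → V → 𝓒 → ℝ)
    (tc : V → 𝓕 → 𝓒 → ℝ) (td : V → 𝓒 → ℝ) (ptd : V → 𝓒 → ℝ) (i : V) (k : 𝓒) : ℝ :=
  min (net.Ld k * deriv (net.Bc i) (net.Yl yc yd i))
    ((net.nbr i).inf' (net.nbr_nonempty i)
      (fun j => td i k * net.deltaD φc φd tc td ptd i j k))

end Net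

/-- First-order optimality of a linear function over a simplex with one distinguished vertex:
coordinates used with positive weight have minimal cost. -/
theorem eq_min_inf'_of_simplex_variation_nonneg {α : Type*} [DecidableEq α] (s : Finset α)
    (hs : s.Nonempty) (x c : α → ℝ) (x₀ c₀ : ℝ) (hx : ∀ a ∈ s, 0 ≤ x a) (hx₀ : 0 ≤ x₀)
    (hsum : ∑ a ∈ s, x a + x₀ = 1)
    (h : ∀ (p : α → ℝ) (q : ℝ), (∀ a, 0 ≤ p a) → 0 ≤ q → (∀ a, a ∉ s → p a = 0) →
      ∑ a ∈ s, p a + q = 1 → 0 ≤ ∑ a ∈ s, c a * (p a - x a) + c₀ * (q - x₀)) :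
    (0 < x₀ → c₀ = min c₀ (s.inf' hs c)) ∧
      ∀ a ∈ s, 0 < x a → c a = min c₀ (s.inf' hs c) := by
  set l := min c₀ (s.inf' hs c) with hl
  have hl₀ : l ≤ c₀ := min_le_left _ _
  have hlc : ∀ a ∈ s, l ≤ c a := fun a ha => (min_le_right _ _).trans (Finset.inf'_le c ha)
  have hmean : ∑ a ∈ s, c a * x a + c₀ * x₀ ≤ l := by
    refine le_min ?_ (Finset.le_inf' _ _ fun b hb => ?_)
    · have := h (fun _ => 0) 1 (fun _ => le_rfl) zero_le_one (fun _ _ => rfl) (by simp)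
      simp only [zero_sub, mul_neg, Finset.sum_neg_distrib] at this
      linarith
    · have := h (fun a => if a = b then 1 else 0) 0 (fun a => by split_ifs <;> norm_num) le_rfl
        (fun a ha => if_neg (by rintro rfl; exact ha hb)) (by simp [hb])
      simp only [mul_sub, Finset.sum_sub_distrib, mul_ite, mul_one, mul_zero,
        Finset.sum_ite_eq', hb, if_true] at this
      linarith
  have hgap : ∑ a ∈ s, x a * (c a - l) + x₀ * (c₀ - l) ≤ 0 := by
    have : ∑ a ∈ s, x a * (c a - l) = ∑ a ∈ s, c a * x a - l * ∑ a ∈ s, x a := by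
      rw [Finset.mul_sum, ← Finset.sum_sub_distrib]
      exact Finset.sum_congr rfl fun a _ => by ring
    rw [this]
    linear_combination hmean - l * hsum
  have hnn : ∀ a ∈ s, 0 ≤ x a * (c a - l) := fun a ha =>
    mul_nonneg (hx a ha) (sub_nonneg.2 (hlc a ha))
  have hnn₀ : 0 ≤ x₀ * (c₀ - l) := mul_nonneg hx₀ (sub_nonneg.2 hl₀)
  have hsnn := Finset.sum_nonneg hnn
  refine ⟨fun hpos => ?_, fun a ha hpos => ?_⟩
  · have : x₀ * (c₀ - l) = 0 := by linarith
    rcases mul_eq_zero.1 this with h0 | h0 <;> linarith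
  · have hle := Finset.single_le_sum hnn ha
    have : x a * (c a - l) = 0 := le_antisymm (by linarith) (hnn a ha)
    rcases mul_eq_zero.1 this with h0 | h0 <;> linarith

/-- A sum over a product of three finite types whose terms vanish off one point. -/
theorem sum_sum_sum_eq_single {α β γ M : Type*} [Fintype α] [Fintype β] [Fintype γ]
    [AddCommMonoid M] (f : α → β → γ → M) (a : α) (b : β) (c : γ)
    (h : ∀ a' b' c', ¬ (a' = a ∧ b' = b ∧ c' = c) → f a' b' c' = 0) :
    ∑ a', ∑ b', ∑ c', f a' b' c' = f a b c := by
  rw [Finset.sum_eq_single a, Finset.sum_eq_single b, Finset.sum_eq_single c]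
  · exact fun c' _ hc => h _ _ _ fun h' => hc h'.2.2
  · simp
  · exact fun b' _ hb => Finset.sum_eq_zero fun c' _ => h _ _ _ fun h' => hb h'.2.1
  · simp
  · exact fun a' _ ha => Finset.sum_eq_zero fun b' _ => Finset.sum_eq_zero fun c' _ =>
      h _ _ _ fun h' => ha h'.1
  · simp

/-- A sum over a product of two finite types whose terms vanish off one point. -/
theorem sum_sum_eq_single {α β M : Type*} [Fintype α] [Fintype β]
    [AddCommMonoid M] (f : α → β → M) (a : α) (b : β)
    (h : ∀ a' b', ¬ (a' = a ∧ b' = b) → f a' b' = 0) :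
    ∑ a', ∑ b', f a' b' = f a b := by
  rw [Finset.sum_eq_single a, Finset.sum_eq_single b]
  · exact fun b' _ hb => h _ _ fun h' => hb h'.2
  · simp
  · exact fun a' _ ha => Finset.sum_eq_zero fun b' _ => h _ _ fun h' => ha h'.1
  · simp

theorem sum_insert_none_image_some {V : Type*} [DecidableEq V] (s : Finset V)
    (f : Option V → ℝ) :
    ∑ j ∈ insert (none : Option V) (s.image some), f j = f none + ∑ j ∈ s, f (some j) := by
  rw [Finset.sum_insert (by simp), Finset.sum_image (by simp)]

namespace Net

variable {V 𝓕 𝓒 : Type} [Fintype V] [DecidableEq V] [Fintype 𝓕] [Fintype 𝓒]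

theorem sum_eq_sum_nbr (net : Net V 𝓕 𝓒) (i : V) (p : V → ℝ)
    (hp : ∀ j, (i, j) ∉ net.E → p j = 0) : ∑ j, p j = ∑ j ∈ net.nbr i, p j := by
  refine (Finset.sum_subset (Finset.subset_univ _) fun j _ hj => hp j fun hE => hj ?_).symm
  simp [nbr, hE]

open Classical in
/-- Replacing one computation block `(i,m,k)` by a point of its simplex preserves feasibility. -/
theorem Feasible.replaceC {net : Net V 𝓕 𝓒} {yc : V → 𝓕 → 𝓒 → ℝ} {yd : V → 𝓒 → ℝ}
    {φc : V → Option V → 𝓕 → 𝓒 → ℝ} {φd : V → V → 𝓒 → ℝ}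
    (hf : net.Feasible yc yd φc φd) (i : V) (m : 𝓕) (k : 𝓒) {p : Option V → ℝ} {q : ℝ}
    (hp : ∀ j, 0 ≤ p j) (hq : 0 ≤ q) (hE : ∀ j, (i, j) ∉ net.E → p (some j) = 0)
    (hsum : p none + ∑ j, p (some j) + q = 1) :
    net.Feasible (fun i' m' k' => if i' = i ∧ m' = m ∧ k' = k then q else yc i' m' k') yd
      (fun i' j m' k' => if i' = i ∧ m' = m ∧ k' = k then p j else φc i' j m' k') φd := by
  obtain ⟨⟨hc, hd, hcE, hdE⟩, hyc, hyd, hsc, hsd⟩ := hf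
  have hsnn : 0 ≤ ∑ j, p (some j) := Finset.sum_nonneg fun j _ => hp _
  have hp1 : ∀ j, p j ≤ 1
    | none => by linarith
    | some j => by
      have := Finset.single_le_sum (f := fun j => p (some j)) (fun j _ => hp _)
        (Finset.mem_univ j)
      have := hp none
      linarith
  refine ⟨⟨fun i' j m' k' => ?_, hd, fun i' j m' k' h => ?_, hdE⟩, fun i' m' k' => ?_, hyd,
    fun i' m' k' => ?_, hsd⟩
  · dsimp only
    split_ifs
    exacts [⟨hp j, hp1 j⟩, hc i' j m' k']
  · dsimp only
    split_ifs with h'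
    exacts [hE j (h'.1 ▸ h), hcE i' j m' k' h]
  · dsimp only
    split_ifs
    exacts [⟨hq, by linarith [hp none]⟩, hyc i' m' k']
  · dsimp only
    split_ifs
    exacts [hsum, hsc i' m' k']

open Classical in
/-- Replacing one data block `(i,k)`, `i ∉ S_k`, by a point of its simplex preserves
feasibility. -/
theorem Feasible.replaceD {net : Net V 𝓕 𝓒} {yc : V → 𝓕 → 𝓒 → ℝ} {yd : V → 𝓒 → ℝ}
    {φc : V → Option V → 𝓕 → 𝓒 → ℝ} {φd : V → V → 𝓒 → ℝ}
    (hf : net.Feasible yc yd φc φd) (i : V) (k : 𝓒) (hi : i ∉ net.Sv k) {p : V → ℝ} {q : ℝ}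
    (hp : ∀ j, 0 ≤ p j) (hq : 0 ≤ q) (hE : ∀ j, (i, j) ∉ net.E → p j = 0)
    (hsum : ∑ j, p j + q = 1) :
    net.Feasible yc (fun i' k' => if i' = i ∧ k' = k then q else yd i' k') φc
      (fun i' j k' => if i' = i ∧ k' = k then p j else φd i' j k') := by
  obtain ⟨⟨hc, hd, hcE, hdE⟩, hyc, hyd, hsc, hsd⟩ := hf
  have hsnn : 0 ≤ ∑ j, p j := Finset.sum_nonneg fun j _ => hp _
  have hp1 : ∀ j, p j ≤ 1 := fun j => by
    have := Finset.single_le_sum (fun j _ => hp j) (Finset.mem_univ j)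
    linarith
  refine ⟨⟨hc, fun i' j k' => ?_, hcE, fun i' j k' h => ?_⟩, hyc, fun i' k' => ?_, hsc,
    fun i' k' => ?_⟩
  · dsimp only
    split_ifs
    exacts [⟨hp j, hp1 j⟩, hd i' j k']
  · dsimp only
    split_ifs with h'
    · obtain ⟨rfl, rfl⟩ := h'
      exact hE j (h.resolve_right hi)
    · exact hdE i' j k' h
  · dsimp only
    split_ifs
    exacts [⟨hq, by linarith⟩, hyd i' k']
  · by_cases h' : i' = i ∧ k' = k
    · obtain ⟨rfl, rfl⟩ := h'
      simpa [hi] using hsum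
    · simpa only [h', if_false] using hsd i' k'

end Net

open Net in
/-- **Lemma 4.1 of "LOAM" (KKT necessary condition).** If a loop-free feasible `(y,φ)` is
stationary for the aggregated cost minimization problem — the first-order variation of `T`
(expressed via the closed-form partial derivatives (8), (10), (12)) towards every feasible
pair is nonnegative — then the partial derivatives equal the blockwise minima `λc_{imk}`,
`λd_{ik}` on every strictly used direction, and dominate them in general. -/
theorem kkt_necessary_condition {V 𝓕 𝓒 : Type} [Fintype V] [DecidableEq V]
    [Fintype 𝓕] [Fintype 𝓒] (net : Net V 𝓕 𝓒)
    (yc : V → 𝓕 → 𝓒 → ℝ) (yd : V → 𝓒 → ℝ)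
    (φc : V → Option V → 𝓕 → 𝓒 → ℝ) (φd : V → V → 𝓒 → ℝ)
    (tc : V → 𝓕 → 𝓒 → ℝ) (td : V → 𝓒 → ℝ)
    (ptc : V → 𝓕 → 𝓒 → ℝ) (ptd : V → 𝓒 → ℝ)
    (hfeas : net.Feasible yc yd φc φd) (hlf : net.LoopFree φc φd)
    (htraf : net.IsTraffic φc φd tc td)
    (hmarg : net.IsMarginal φc φd tc td ptc ptd)
    (hstat : ∀ (yc' : V → 𝓕 → 𝓒 → ℝ) (yd' : V → 𝓒 → ℝ)
      (φc' : V → Option V → 𝓕 → 𝓒 → ℝ) (φd' : V → V → 𝓒 → ℝ),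
      net.Feasible yc' yd' φc' φd' →
      0 ≤ (∑ i, ∑ m, ∑ k,
            ((tc i m k * net.deltaC φc φd tc td ptc ptd i none m k) *
                (φc' i none m k - φc i none m k) +
              ∑ j ∈ net.nbr i,
                (tc i m k * net.deltaC φc φd tc td ptc ptd i (some j) m k) *
                  (φc' i (some j) m k - φc i (some j) m k))) +
          (∑ i, ∑ k, ∑ j ∈ net.nbr i,
            (td i k * net.deltaD φc φd tc td ptd i j k) * (φd' i j k - φd i j k)) +
          (∑ i, ∑ m, ∑ k,
            (net.Lc m k * deriv (net.Bc i) (net.Yl yc yd i)) * (yc' i m k - yc i m k)) +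
          ∑ i, ∑ k,
            (net.Ld k * deriv (net.Bc i) (net.Yl yc yd i)) * (yd' i k - yd i k)) :
    ∀ (i : V) (m : 𝓕) (k : 𝓒),
      (0 < φc i none m k →
        tc i m k * net.deltaC φc φd tc td ptc ptd i none m k =
          net.lamC yc yd φc φd tc td ptc ptd i m k) ∧
      (net.lamC yc yd φc φd tc td ptc ptd i m k ≤
        tc i m k * net.deltaC φc φd tc td ptc ptd i none m k) ∧
      (∀ j ∈ net.nbr i,
        (0 < φc i (some j) m k →
          tc i m k * net.deltaC φc φd tc td ptc ptd i (some j) m k =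
            net.lamC yc yd φc φd tc td ptc ptd i m k) ∧
        net.lamC yc yd φc φd tc td ptc ptd i m k ≤
          tc i m k * net.deltaC φc φd tc td ptc ptd i (some j) m k) ∧
      (0 < yc i m k →
        net.Lc m k * deriv (net.Bc i) (net.Yl yc yd i) =
          net.lamC yc yd φc φd tc td ptc ptd i m k) ∧
      (net.lamC yc yd φc φd tc td ptc ptd i m k ≤
        net.Lc m k * deriv (net.Bc i) (net.Yl yc yd i)) ∧
      (∀ j ∈ net.nbr i,
        (0 < φd i j k →
          td i k * net.deltaD φc φd tc td ptd i j k =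
            net.lamD yc yd φc φd tc td ptd i k) ∧
        net.lamD yc yd φc φd tc td ptd i k ≤
          td i k * net.deltaD φc φd tc td ptd i j k) ∧
      (0 < yd i k →
        net.Ld k * deriv (net.Bc i) (net.Yl yc yd i) =
          net.lamD yc yd φc φd tc td ptd i k) ∧
      net.lamD yc yd φc φd tc td ptd i k ≤
        net.Ld k * deriv (net.Bc i) (net.Yl yc yd i) := by
  classical
  intro i m k
  have hf := hfeas
  obtain ⟨⟨hc, hd, hcE, hdE⟩, hyc, hyd, hsc, hsd⟩ := hf
  have hC := eq_min_inf'_of_simplex_variation_nonneg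
    (insert (none : Option V) ((net.nbr i).image some)) (Finset.insert_nonempty _ _)
    (fun j => φc i j m k) (fun j => tc i m k * net.deltaC φc φd tc td ptc ptd i j m k)
    (yc i m k) (net.Lc m k * deriv (net.Bc i) (net.Yl yc yd i))
    (fun j _ => (hc i j m k).1) (hyc i m k).1
    (by
      rw [sum_insert_none_image_some, ← net.sum_eq_sum_nbr i (fun j => φc i (some j) m k)
        fun j hj => hcE i j m k hj]
      exact hsc i m k)
    (by
      intro p q hp hq hps hsum
      have hE : ∀ j, (i, j) ∉ net.E → p (some j) = 0 := fun j hj => hps _ (by simp [nbr, hj])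
      rw [sum_insert_none_image_some, ← net.sum_eq_sum_nbr i _ hE] at hsum
      have := hstat _ _ _ _ (hfeas.replaceC i m k hp hq hE hsum)
      rw [sum_sum_sum_eq_single _ i m k (fun i' m' k' h => by simp [h]),
        sum_sum_sum_eq_single _ i m k (fun i' m' k' h => by simp [h])] at this
      rw [sum_insert_none_image_some]
      simpa using this)
  have hD : (0 < yd i k → net.Ld k * deriv (net.Bc i) (net.Yl yc yd i) =
        net.lamD yc yd φc φd tc td ptd i k) ∧
      ∀ j ∈ net.nbr i, 0 < φd i j k → td i k * net.deltaD φc φd tc td ptd i j k =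
        net.lamD yc yd φc φd tc td ptd i k := by
    by_cases hi : i ∈ net.Sv k
    · have hz : ∀ j, φd i j k = 0 := fun j => hdE i j k (Or.inr hi)
      have hy : yd i k = 0 := by simpa [hz, hi] using hsd i k
      exact ⟨fun h => absurd h (by simp [hy]), fun j _ h => absurd h (by simp [hz])⟩
    · refine eq_min_inf'_of_simplex_variation_nonneg (net.nbr i) (net.nbr_nonempty i)
        (fun j => φd i j k) (fun j => td i k * net.deltaD φc φd tc td ptd i j k)
        (yd i k) (net.Ld k * deriv (net.Bc i) (net.Yl yc yd i))
        (fun j _ => (hd i j k).1) (hyd i k).1 ?_ ?_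
      · rw [← net.sum_eq_sum_nbr i (fun j => φd i j k) fun j hj => hdE i j k (Or.inl hj)]
        simpa [hi] using hsd i k
      · intro p q hp hq hps hsum
        have hE : ∀ j, (i, j) ∉ net.E → p j = 0 := fun j hj => hps _ (by simp [nbr, hj])
        rw [← net.sum_eq_sum_nbr i _ hE] at hsum
        have := hstat _ _ _ _ (hfeas.replaceD i k hi hp hq hE hsum)
        rw [sum_sum_eq_single _ i k (fun i' k' h => by simp [h]),
          sum_sum_eq_single _ i k (fun i' k' h => by simp [h])] at this
        simpa using this
  have hCle : ∀ j ∈ insert (none : Option V) ((net.nbr i).image some),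
      net.lamC yc yd φc φd tc td ptc ptd i m k ≤
        tc i m k * net.deltaC φc φd tc td ptc ptd i j m k := fun j hj =>
    (min_le_right _ _).trans (Finset.inf'_le
      (fun j => tc i m k * net.deltaC φc φd tc td ptc ptd i j m k) hj)
  have hsome : ∀ j ∈ net.nbr i,
      some j ∈ insert (none : Option V) ((net.nbr i).image some) := fun j hj => by simp [hj]
  exact ⟨hC.2 none (Finset.mem_insert_self _ _), hCle none (Finset.mem_insert_self _ _),
    fun j hj => ⟨hC.2 (some j) (hsome j hj), hCle (some j) (hsome j hj)⟩,
    hC.1, min_le_left _ _,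
    fun j hj => ⟨hD.2 j hj, (min_le_right _ _).trans
      (Finset.inf'_le (fun j => td i k * net.deltaD φc φd tc td ptd i j k) hj)⟩,
    hD.1, min_le_left _ _⟩
end

section
/- First-order optimality over a product of simplices (abstract core of Lemma 4.1): Let ι be a finite index set partitioned into nonempty blocks (B_g)_{g∈Γ}, and let S := {x : ι → ℝ | x_l ≥ 0 for all l, and Σ_{l∈B_g} x_l = 1 for every g ∈ Γ}. Let f : (ι → ℝ) → ℝ be Fréchet differentiable at x* ∈ S, and suppose x* is a local minimizer of f on S. Then for each block g, setting λ_g := min_{l∈B_g} ∂f/∂x_l(x*) (where ∂f/∂x_l(x*) denotes the derivative of f at x* applied to the l-th coordinate basis vector), one has ∂f/∂x_l(x*) = λ_g for every l ∈ B_g with x*_l > 0, and ∂f/∂x_l(x*) ≥ λ_g for every l ∈ B_g. -/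
open Finset

/-- The product of the standard simplices indexed by the fibers of `blk` is convex. -/
theorem convex_product_simplices {ι Γ : Type*} [Fintype ι] [DecidableEq Γ] (blk : ι → Γ) :
    Convex ℝ {z : ι → ℝ | (∀ l, 0 ≤ z l) ∧
      ∀ g : Γ, ∑ l ∈ Finset.univ.filter (fun l => blk l = g), z l = 1} := by
  rintro x ⟨hx, hxs⟩ y ⟨hy, hys⟩ a b ha hb hab
  refine ⟨fun l => ?_, fun g => ?_⟩
  · simpa using add_nonneg (mul_nonneg ha (hx l)) (mul_nonneg hb (hy l))
  · simp only [Pi.add_apply, Pi.smul_apply, smul_eq_mul, Finset.sum_add_distrib,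
      ← Finset.mul_sum, hxs, hys, mul_one, hab]

/-- Moving the whole mass of a coordinate to another coordinate of the same block preserves
membership in a product of simplices. -/
theorem add_smul_single_sub_single_mem_product_simplices
    {ι Γ : Type*} [Fintype ι] [DecidableEq ι] [DecidableEq Γ] (blk : ι → Γ) {x : ι → ℝ}
    (hx : x ∈ {z : ι → ℝ | (∀ l, 0 ≤ z l) ∧
      ∀ g : Γ, ∑ l ∈ Finset.univ.filter (fun l => blk l = g), z l = 1})
    {l m : ι} (hlm : blk l = blk m) :
    x + x l • (Pi.single m 1 - Pi.single l 1) ∈ {z : ι → ℝ | (∀ l, 0 ≤ z l) ∧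
      ∀ g : Γ, ∑ l ∈ Finset.univ.filter (fun l => blk l = g), z l = 1} := by
  obtain ⟨hx0, hxs⟩ := hx
  refine ⟨fun k => ?_, fun g => ?_⟩
  · have hk := hx0 k
    have hl := hx0 l
    simp only [Pi.add_apply, Pi.smul_apply, Pi.sub_apply, Pi.single_apply, smul_eq_mul]
    split_ifs with h₁ h₂ h₂ <;> subst_vars <;> linarith
  · simp only [Pi.add_apply, Pi.smul_apply, Pi.sub_apply, smul_eq_mul, Finset.sum_add_distrib,
      ← Finset.mul_sum, Finset.sum_sub_distrib, hxs,
      Finset.mem_filter, Finset.mem_univ, true_and, hlm, sub_self, mul_zero, add_zero,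
      Pi.single_apply, Finset.sum_ite_eq']

/-- **First-order optimality over a product of simplices** (abstract core of Lemma 4.1 of
"LOAM"): if `x*` is a local minimizer on the product of simplices `S` of a function `f` that
is Fréchet differentiable at `x*`, then within each block the partial derivatives at
coordinates with positive value all equal the blockwise minimum `λ_g` of the partial
derivatives, and all partial derivatives in the block are `≥ λ_g`. -/
theorem first_order_optimality_product_simplices
    {ι Γ : Type*} [Fintype ι] [DecidableEq ι] [DecidableEq Γ]
    (blk : ι → Γ) (hsurj : Function.Surjective blk)
    (f : (ι → ℝ) → ℝ) (xstar : ι → ℝ) (f' : (ι → ℝ) →L[ℝ] ℝ)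
    (hderiv : HasFDerivAt f f' xstar)
    (hxS : (∀ l, 0 ≤ xstar l) ∧
      ∀ g : Γ, ∑ l ∈ Finset.univ.filter (fun l => blk l = g), xstar l = 1)
    (hmin : IsLocalMinOn f
      {z : ι → ℝ | (∀ l, 0 ≤ z l) ∧
        ∀ g : Γ, ∑ l ∈ Finset.univ.filter (fun l => blk l = g), z l = 1} xstar) :
    ∀ g : Γ, ∀ hne : (Finset.univ.filter (fun l => blk l = g)).Nonempty,
      ∀ l ∈ Finset.univ.filter (fun l => blk l = g),
        (0 < xstar l →
          f' (Pi.single l 1) =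
            (Finset.univ.filter (fun l => blk l = g)).inf' hne
              (fun l' => f' (Pi.single l' 1))) ∧
        (Finset.univ.filter (fun l => blk l = g)).inf' hne
            (fun l' => f' (Pi.single l' 1)) ≤ f' (Pi.single l 1) := by
  intro g hne l hl
  have hle := Finset.inf'_le (fun l' => f' (Pi.single l' 1)) hl
  refine ⟨fun hpos => le_antisymm (Finset.le_inf' hne _ fun m hm => ?_) hle, hle⟩
  have hlm : blk l = blk m := (Finset.mem_filter.mp hl).2.trans (Finset.mem_filter.mp hm).2.symm
  have hmem := add_smul_single_sub_single_mem_product_simplices blk hxS hlm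
  have hseg := (convex_product_simplices blk).segment_subset hxS hmem
  have hnonneg := hmin.hasFDerivWithinAt_nonneg hderiv.hasFDerivWithinAt
    (mem_posTangentConeAt_of_segment_subset hseg)
  rw [map_smul, map_sub, smul_eq_mul] at hnonneg
  exact sub_nonneg.mp (nonneg_of_mul_nonneg_right hnonneg hpos)
end

section
/- Composition with a convex nondecreasing function yields increasing differences (core of the proof of Lemma 3.1): Let F : (Fin n → ℝ) → ℝ be given by F(x) = Σ_{S ⊆ Fin n} c_S · Π_{i∈S} x_i with all coefficients c_S ≥ 0, and let D : ℝ → ℝ be convex and nondecreasing on [0, ∞). Then for all x, y with 0 ≤ x ≤ y componentwise, every coordinate i, and every a ≥ 0: D(F(x + a·e_i)) − D(F(x)) ≤ D(F(y + a·e_i)) − D(F(y)). Equivalently, −(D ∘ F) is DR-submodular on the nonnegative orthant. -/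
/-- A multilinear polynomial with nonnegative coefficients:
`F x = ∑_{S ⊆ Fin n} c S · ∏_{i ∈ S} x i`. -/
noncomputable def multilinearPoly {n : ℕ} (c : Finset (Fin n) → ℝ) (x : Fin n → ℝ) : ℝ :=
  ∑ S : Finset (Fin n), c S * ∏ i ∈ S, x i

theorem ConvexOn.add_le_add_of_shift {s : Set ℝ} {D : ℝ → ℝ} (hD : ConvexOn ℝ s D)
    {u v p : ℝ} (hu : u ∈ s) (hvp : v + p ∈ s) (huv : u ≤ v) (hp : 0 ≤ p) :
    D (u + p) + D v ≤ D u + D (v + p) := by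
  rcases huv.eq_or_lt with rfl | hlt
  · linarith
  have hL : 0 < v - u + p := by linarith
  have hsum : (v - u) / (v - u + p) + p / (v - u + p) = 1 := by field_simp
  have ht : 0 ≤ (v - u) / (v - u + p) := div_nonneg (by linarith) hL.le
  have ht' : 0 ≤ p / (v - u + p) := div_nonneg hp hL.le
  have h₁ := hD.2 hu hvp ht ht' hsum
  have h₂ := hD.2 hu hvp ht' ht (by linarith)
  simp only [smul_eq_mul] at h₁ h₂
  have e₁ : (v - u) / (v - u + p) * u + p / (v - u + p) * (v + p) = u + p := by
    field_simp
    ring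
  have e₂ : p / (v - u + p) * u + (v - u) / (v - u + p) * (v + p) = v := by
    field_simp
    ring
  rw [e₁] at h₁
  rw [e₂] at h₂
  linear_combination h₁ + h₂ + (D u + D (v + p)) * hsum

theorem Finset.prod_add_smul_single_sub_prod {ι : Type*} [DecidableEq ι] (S : Finset ι)
    (x : ι → ℝ) (i : ι) (a : ℝ) :
    ∏ j ∈ S, (x + a • (Pi.single i 1 : ι → ℝ)) j - ∏ j ∈ S, x j =
      if i ∈ S then a * ∏ j ∈ S.erase i, x j else 0 := by
  have hne : ∀ j, j ≠ i → (x + a • (Pi.single i 1 : ι → ℝ)) j = x j := fun j hj => by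
    simp [hj]
  split_ifs with hi
  · rw [← Finset.mul_prod_erase S _ hi, ← Finset.mul_prod_erase S x hi,
      Finset.prod_congr rfl fun j hj => hne j (Finset.ne_of_mem_erase hj)]
    simp
    ring
  · rw [Finset.prod_congr rfl fun j hj => hne j (ne_of_mem_of_not_mem hj hi), sub_self]

section multilinearPoly

variable {n : ℕ} {c : Finset (Fin n) → ℝ}

theorem multilinearPoly_nonneg (hc : ∀ S, 0 ≤ c S) {x : Fin n → ℝ} (hx : 0 ≤ x) :
    0 ≤ multilinearPoly c x :=
  Finset.sum_nonneg fun S _ => mul_nonneg (hc S) (Finset.prod_nonneg fun j _ => hx j)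

theorem multilinearPoly_mono (hc : ∀ S, 0 ≤ c S) {x y : Fin n → ℝ} (hx : 0 ≤ x)
    (hxy : x ≤ y) : multilinearPoly c x ≤ multilinearPoly c y :=
  Finset.sum_le_sum fun S _ => mul_le_mul_of_nonneg_left
    (Finset.prod_le_prod (fun j _ => hx j) fun j _ => hxy j) (hc S)

theorem multilinearPoly_increasing_differences (hc : ∀ S, 0 ≤ c S) {x y : Fin n → ℝ}
    (hx : 0 ≤ x) (hxy : x ≤ y) (i : Fin n) {a : ℝ} (ha : 0 ≤ a) :
    multilinearPoly c (x + a • (Pi.single i 1 : Fin n → ℝ)) - multilinearPoly c x ≤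
      multilinearPoly c (y + a • (Pi.single i 1 : Fin n → ℝ)) - multilinearPoly c y := by
  simp only [multilinearPoly, ← Finset.sum_sub_distrib, ← mul_sub,
    Finset.prod_add_smul_single_sub_prod]
  refine Finset.sum_le_sum fun S _ => mul_le_mul_of_nonneg_left ?_ (hc S)
  split_ifs
  · exact mul_le_mul_of_nonneg_left
      (Finset.prod_le_prod (fun j _ => hx j) fun j _ => hxy j) ha
  · exact le_rfl

end multilinearPoly

/-- **Composition with a convex nondecreasing function yields increasing differences**
(core of the proof of Lemma 3.1 of "LOAM"): if `F` is multilinear with nonnegative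
coefficients and `D` is convex and nondecreasing on `[0,∞)`, then `D ∘ F` has increasing
differences on the nonnegative orthant; equivalently `-(D ∘ F)` is DR-submodular there. -/
theorem comp_convexMonotone_multilinear_increasing_differences {n : ℕ}
    (c : Finset (Fin n) → ℝ) (hc : ∀ S, 0 ≤ c S)
    (D : ℝ → ℝ) (hD : ConvexOn ℝ (Set.Ici 0) D) (hmono : MonotoneOn D (Set.Ici 0)) :
    ∀ x y : Fin n → ℝ, 0 ≤ x → x ≤ y →
      ∀ (i : Fin n) (a : ℝ), 0 ≤ a →
        D (multilinearPoly c (x + a • (Pi.single i 1 : Fin n → ℝ))) - D (multilinearPoly c x) ≤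
          D (multilinearPoly c (y + a • (Pi.single i 1 : Fin n → ℝ))) - D (multilinearPoly c y) := by
  intro x y hx hxy i a ha
  have hstep : ∀ z : Fin n → ℝ, z ≤ z + a • (Pi.single i 1 : Fin n → ℝ) := fun z =>
    le_add_of_nonneg_right (smul_nonneg ha (Pi.single_nonneg.2 zero_le_one))
  have hu := multilinearPoly_nonneg hc hx
  have huv := multilinearPoly_mono hc hx hxy
  have hp := multilinearPoly_mono hc hx (hstep x)
  have hpq := multilinearPoly_increasing_differences hc hx hxy i ha
  set u := multilinearPoly c x
  set v := multilinearPoly c y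
  set u' := multilinearPoly c (x + a • (Pi.single i 1 : Fin n → ℝ))
  set v' := multilinearPoly c (y + a • (Pi.single i 1 : Fin n → ℝ))
  have hvp : v + (u' - u) ∈ Set.Ici (0 : ℝ) := Set.mem_Ici.2 (by linarith)
  have hconv := hD.add_le_add_of_shift (Set.mem_Ici.2 hu) hvp huv (sub_nonneg.2 hp)
  have hle : D (v + (u' - u)) ≤ D v' :=
    hmono hvp (Set.mem_Ici.2 (by linarith)) (by linarith)
  rw [add_sub_cancel] at hconv
  linarith
end

section
/- Second-order criterion for diminishing returns: Let u ≤ v in ℝⁿ, let U be an open convex set containing the box [u, v] := {x : u ≤ x ≤ v componentwise}, and let g : U → ℝ be twice continuously differentiable with ∂²g/∂x_i∂x_j ≤ 0 on [u, v] for all pairs of coordinates i, j (including i = j). Then for all x, y ∈ [u, v] with x ≤ y componentwise, every coordinate i, and every a ≥ 0 such that x + a·e_i ∈ [u, v] and y + a·e_i ∈ [u, v]: g(x + a·e_i) − g(x) ≥ g(y + a·e_i) − g(y). -/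
/-- A function on a box whose partial derivatives are all nonpositive is antitone there. -/
theorem antitoneOn_Icc_of_fderiv_single_nonpos {ι : Type*} [Fintype ι] [DecidableEq ι]
    {u v : ι → ℝ} {f : (ι → ℝ) → ℝ} (hf : ∀ x ∈ Set.Icc u v, DifferentiableAt ℝ f x)
    (hf' : ∀ x ∈ Set.Icc u v, ∀ i, fderiv ℝ f x (Pi.single i 1) ≤ 0) :
    AntitoneOn f (Set.Icc u v) := by
  intro x hx y hy hxy
  obtain ⟨z, hz, h⟩ := domain_mvt
    (fun z hz => (hf z hz).hasFDerivAt.hasFDerivWithinAt) (convex_Icc u v) hx hy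
  have hz' : z ∈ Set.Icc u v := (convex_Icc u v).segment_subset hx hy hz
  rw [pi_eq_sum_univ' (y - x), map_sum] at h
  have hsum : ∑ i, fderiv ℝ f z ((y - x) i • Pi.single i 1) ≤ 0 :=
    Finset.sum_nonpos fun i _ => by
      rw [map_smul, smul_eq_mul]
      exact mul_nonpos_of_nonneg_of_nonpos (sub_nonneg.2 (hxy i)) (hf' z hz' i)
  linarith

/-- **Second-order criterion for diminishing returns** (used in the proof of Lemma 3.1 of
"LOAM"): if `g` is twice continuously differentiable on an open convex set `U` containing the
box `[u,v]` and all second partial derivatives are nonpositive on the box, then `g` has the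
diminishing-returns (DR-submodularity) property on `[u,v]`. -/
theorem second_order_criterion_DR {n : ℕ} (u v : Fin n → ℝ) (hu : u ≤ v)
    (U : Set (Fin n → ℝ)) (hUopen : IsOpen U) (hUconv : Convex ℝ U)
    (hbox : Set.Icc u v ⊆ U)
    (g : (Fin n → ℝ) → ℝ) (hg : ContDiffOn ℝ 2 g U)
    (hsec : ∀ x ∈ Set.Icc u v, ∀ i j : Fin n,
      fderiv ℝ (fun z => fderiv ℝ g z (Pi.single j 1)) x (Pi.single i 1) ≤ 0) :
    ∀ x ∈ Set.Icc u v, ∀ y ∈ Set.Icc u v, x ≤ y →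
      ∀ (i : Fin n) (a : ℝ), 0 ≤ a →
        x + a • (Pi.single i 1 : Fin n → ℝ) ∈ Set.Icc u v →
        y + a • (Pi.single i 1 : Fin n → ℝ) ∈ Set.Icc u v →
        g (x + a • (Pi.single i 1 : Fin n → ℝ)) - g x ≥
          g (y + a • (Pi.single i 1 : Fin n → ℝ)) - g y := by
  intro x hx y hy hxy i a ha hxa hya
  have hg1 : ∀ z ∈ Set.Icc u v, DifferentiableAt ℝ g z := fun z hz =>
    (hg.contDiffAt (hUopen.mem_nhds (hbox hz))).differentiableAt two_ne_zero
  have hg2 : ∀ z ∈ Set.Icc u v,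
      DifferentiableAt ℝ (fun w => fderiv ℝ g w (Pi.single i 1)) z := fun z hz =>
    (((hg.contDiffAt (hUopen.mem_nhds (hbox hz))).fderiv_right (m := 1)
      (by norm_num)).differentiableAt one_ne_zero).clm_apply (differentiableAt_const _)
  have hanti := antitoneOn_Icc_of_fderiv_single_nonpos hg2 fun z hz j => hsec z hz j i
  have hd : 0 ≤ y - x := sub_nonneg.2 hxy
  have hleft : ∀ z ∈ Set.Icc u (v - (y - x)), z ∈ Set.Icc u v := fun z hz =>
    ⟨hz.1, hz.2.trans (sub_le_self v hd)⟩
  have hright : ∀ z ∈ Set.Icc u (v - (y - x)), z + (y - x) ∈ Set.Icc u v := fun z hz =>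
    ⟨hz.1.trans (le_add_of_nonneg_right hd), le_sub_iff_add_le.1 hz.2⟩
  have hshift : x + a • (Pi.single i 1 : Fin n → ℝ) + (y - x) = y + a • Pi.single i 1 := by abel
  have hxs : x ∈ Set.Icc u (v - (y - x)) := ⟨hx.1, le_sub_iff_add_le.2 (by simpa using hy.2)⟩
  have hxas : x + a • Pi.single i 1 ∈ Set.Icc u (v - (y - x)) :=
    ⟨hxa.1, le_sub_iff_add_le.2 (hshift ▸ hya.2)⟩
  obtain ⟨z, hz, h⟩ := domain_mvt (f := fun z => g (z + (y - x)) - g z)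
    (f' := fun z => fderiv ℝ g (z + (y - x)) - fderiv ℝ g z)
    (s := Set.Icc u (v - (y - x))) (x := x) (y := x + a • Pi.single i 1)
    (fun z hz => (((hasFDerivAt_comp_add_right (y - x)).2 (hg1 _ (hright z hz)).hasFDerivAt).sub
      (hg1 z (hleft z hz)).hasFDerivAt).hasFDerivWithinAt)
    (convex_Icc _ _) hxs hxas
  have hz' : z ∈ Set.Icc u (v - (y - x)) := (convex_Icc _ _).segment_subset hxs hxas hz
  have hle := hanti (hleft z hz') (hright z hz') (le_add_of_nonneg_right hd)
  simp only [hshift, add_sub_cancel, add_sub_cancel_left, map_smul, smul_eq_mul,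
    sub_apply] at h hle
  have := mul_nonpos_of_nonneg_of_nonpos ha (sub_nonpos.2 hle)
  linarith
end

section
/- Potential-based lower bound with absorption (abstract core of Theorem 4.2's sufficiency mechanism): Let I be a finite index set; let A_{ij} ≥ 0 with a_i := 1 − Σ_{j∈I} A_{ij} ≥ 0 for all i; let w_{ij} ≥ 0; let c_i and s_i be real numbers with s_i ≤ w_{ij} + s_j whenever A_{ij} > 0, and s_i ≤ c_i whenever a_i > 0; let r_i ≥ 0 and t_i ≥ 0 satisfy t_i = r_i + Σ_{j∈I} A_{ji} t_j for all i. Then Σ_{i,j∈I} t_i · A_{ij} · w_{ij} + Σ_{i∈I} t_i · a_i · c_i ≥ Σ_{i∈I} r_i · s_i. -/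
/-- **Potential-based lower bound with absorption** (abstract core of Theorem 4.2's
sufficiency mechanism in "LOAM"). `A` is a substochastic forwarding matrix, `a_i = 1 - ∑_j A i j`
the absorption fraction at `i`, `w` per-unit forwarding costs, `c` per-unit absorption costs,
`t` the traffic induced by exogenous inputs `r`, and `s` node potentials satisfying Bellman-type
inequalities along used edges and at absorbing nodes. -/
theorem potential_lower_bound_with_absorption {I : Type*} [Fintype I]
    (A w : I → I → ℝ) (c s r t : I → ℝ)
    (hA : ∀ i j, 0 ≤ A i j)
    (ha : ∀ i, 0 ≤ 1 - ∑ j, A i j)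
    (hw : ∀ i j, 0 ≤ w i j)
    (hs1 : ∀ i j, 0 < A i j → s i ≤ w i j + s j)
    (hs2 : ∀ i, 0 < 1 - ∑ j, A i j → s i ≤ c i)
    (hr : ∀ i, 0 ≤ r i) (htn : ∀ i, 0 ≤ t i)
    (ht : ∀ i, t i = r i + ∑ j, A j i * t j) :
    ∑ i, r i * s i ≤
      (∑ i, ∑ j, t i * (A i j * w i j)) + ∑ i, t i * (1 - ∑ j, A i j) * c i := by
  have balance : ∑ i, r i * s i = ∑ i, t i * s i - ∑ i, ∑ j, t i * (A i j * s j) := by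
    rw [Finset.sum_comm (f := fun i j => t i * (A i j * s j)), ← Finset.sum_sub_distrib]
    refine Finset.sum_congr rfl fun i _ => ?_
    have hsum : ∑ j, t j * (A j i * s i) = (∑ j, A j i * t j) * s i := by
      rw [Finset.sum_mul]
      exact Finset.sum_congr rfl fun j _ => by ring
    rw [hsum]
    linear_combination -s i * ht i
  rw [balance, sub_le_iff_le_add, add_right_comm, ← Finset.sum_add_distrib,
    ← Finset.sum_add_distrib]
  refine Finset.sum_le_sum fun i _ => ?_
  have forwarding : (∑ j, A i j) * s i ≤ ∑ j, A i j * w i j + ∑ j, A i j * s j := by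
    rw [Finset.sum_mul, ← Finset.sum_add_distrib]
    refine Finset.sum_le_sum fun j _ => ?_
    rw [← mul_add]
    rcases (hA i j).eq_or_lt with h | h
    · simp [← h]
    · exact mul_le_mul_of_nonneg_left (hs1 i j h) h.le
  have absorption : (1 - ∑ j, A i j) * s i ≤ (1 - ∑ j, A i j) * c i := by
    rcases (ha i).eq_or_lt with h | h
    · simp [← h]
    · exact mul_le_mul_of_nonneg_left (hs2 i h) h.le
  rw [← Finset.mul_sum, ← Finset.mul_sum, mul_assoc, ← mul_add, ← mul_add]
  exact mul_le_mul_of_nonneg_left (by linarith) (htn i)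
end
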